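/- In ℂ[x,y], let i be the imaginary unit and r = √1407 (the positive real square root of 1407), and define f2 = 1 + 2x^2 - (25/1407)i x^2 r - y^2 + xy + (25/1407)i x r - 2x, g2 = (5/4)y^2 - (5/4)xy + (125/5628)i x^2 r - (1/4)x^2 - (125/5628)i x r + (5/2)x - 5/4, and h2 = -(155/16)y^2 + (2025/3752)i xy r - (11/2)xy - (2025/3752)i y r + (131449/7504)x^2 + (275/2814)i x^2 r - (275/2814)i x r - (138953/3752)x + 138953/7504. Let g = f2^3 + g2^2 * h2. Then g is irreducible in ℂ[x,y], and there do not exist polynomials p, q ∈ ℂ[x,y] with total degree of p at most 2 and total degree of q at most 3 such that g = p^3 + q^2. -/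

import Mathlib

open MvPolynomial

noncomputable section

def x : MvPolynomial (Fin 2) ℂ := X 0
def y : MvPolynomial (Fin 2) ℂ := X 1
def c (q : ℚ) : MvPolynomial (Fin 2) ℂ := C (q : ℂ)

/-- The imaginary unit, as a constant polynomial. -/
def i : MvPolynomial (Fin 2) ℂ := C Complex.I
/-- `r = √1407`, as a constant polynomial. -/
def r : MvPolynomial (Fin 2) ℂ := C ((Real.sqrt 1407 : ℝ) : ℂ)

def f2 : MvPolynomial (Fin 2) ℂ :=
  1 + 2 * x ^ 2 - c (25/1407) * i * x ^ 2 * r - y ^ 2 + x * y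
    + c (25/1407) * i * x * r - 2 * x

def g2 : MvPolynomial (Fin 2) ℂ :=
  c (5/4) * y ^ 2 - c (5/4) * x * y + c (125/5628) * i * x ^ 2 * r - c (1/4) * x ^ 2
    - c (125/5628) * i * x * r + c (5/2) * x - c (5/4)

def h2 : MvPolynomial (Fin 2) ℂ :=
  - c (155/16) * y ^ 2 + c (2025/3752) * i * x * y * r - c (11/2) * x * y
    - c (2025/3752) * i * y * r + c (131449/7504) * x ^ 2 + c (275/2814) * i * x ^ 2 * r
    - c (275/2814) * i * x * r - c (138953/3752) * x + c (138953/7504)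

/-- The sextic of semi-torus type with configuration `[3A_5]` (Method 2). -/
def g : MvPolynomial (Fin 2) ℂ := f2 ^ 3 + g2 ^ 2 * h2

/-! ### Generalities on polynomials in two variables -/

abbrev PP := MvPolynomial (Fin 2) ℂ

def mon (k l : ℕ) : Fin 2 →₀ ℕ := Finsupp.single 0 k + Finsupp.single 1 l

@[simp] theorem mon_zero (k l : ℕ) : mon k l 0 = k := by simp [mon]

@[simp] theorem mon_one (k l : ℕ) : mon k l 1 = l := by simp [mon]

theorem mon_eta (m : Fin 2 →₀ ℕ) : mon (m 0) (m 1) = m := by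
  ext a; fin_cases a <;> simp

theorem mon_inj {k l k' l' : ℕ} : mon k l = mon k' l' ↔ k = k' ∧ l = l' := by
  constructor
  · intro h
    exact ⟨by simpa using DFunLike.congr_fun h 0, by simpa using DFunLike.congr_fun h 1⟩
  · rintro ⟨rfl, rfl⟩; rfl

theorem mon_le {k l k' l' : ℕ} : mon k l ≤ mon k' l' ↔ k ≤ k' ∧ l ≤ l' := by
  rw [Finsupp.le_def, Fin.forall_fin_two]; simp

theorem mon_sub (k l k' l' : ℕ) : mon k l - mon k' l' = mon (k - k') (l - l') := by
  ext a; fin_cases a <;> simp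

theorem mon_sub_zero (k l : ℕ) : mon k l - Finsupp.single 0 1 = mon (k - 1) l := by
  ext a; fin_cases a <;> simp

theorem mon_sub_one (k l : ℕ) : mon k l - Finsupp.single 1 1 = mon k (l - 1) := by
  ext a; fin_cases a <;> simp

theorem mon_add_zero (k l : ℕ) : mon k l + Finsupp.single 0 1 = mon (k + 1) l := by
  ext a; fin_cases a <;> simp

theorem mon_add_one (k l : ℕ) : mon k l + Finsupp.single 1 1 = mon k (l + 1) := by
  ext a; fin_cases a <;> simp

theorem pd_comm (p : PP) : pderiv 1 (pderiv 0 p) = pderiv 0 (pderiv 1 p) := by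
  ext m
  simp only [coeff_pderiv]
  rw [add_right_comm]
  simp
  ring

theorem coeff_big {A : PP} {d : ℕ} (hA : A.totalDegree ≤ d) {k l : ℕ} (h : d < k + l) :
    coeff (mon k l) A = 0 := by
  apply coeff_eq_zero_of_totalDegree_lt
  refine lt_of_le_of_lt hA (lt_of_lt_of_le h ?_)
  have : (mon k l).degree = k + l := by simp [mon, Finsupp.degree_single]
  exact (this.symm.trans rfl).le

theorem pd_degree {A : PP} {d : ℕ} (hA : A.totalDegree ≤ d + 1) (a : Fin 2) :
    (pderiv a A).totalDegree ≤ d := by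
  refine Finset.sup_le fun m hm => ?_
  rw [mem_support_iff, coeff_pderiv] at hm
  have h1 := le_totalDegree (mem_support_iff.mpr (left_ne_zero_of_mul hm))
  rw [Finsupp.sum_add_index' (by simp) (by simp), Finsupp.sum_single_index rfl] at h1
  omega

theorem const_of_pd {A : PP} (h0 : pderiv 0 A = 0) (h1 : pderiv 1 A = 0) :
    A = C (coeff 0 A) := by
  ext m
  rw [coeff_C]
  split_ifs with h
  · rw [h]
  · by_cases hm : m 0 = 0
    · by_cases hm1 : m 1 = 0
      · exact absurd (by ext a; fin_cases a <;> simp [hm, hm1]) h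
      · have := congrArg (coeff (mon (m 0) (m 1 - 1))) h1
        rw [coeff_pderiv, mon_add_one, Nat.sub_add_cancel (Nat.pos_of_ne_zero hm1), mon_eta] at this
        simp only [coeff_zero, mul_eq_zero] at this
        exact this.resolve_right (Nat.cast_add_one_ne_zero _)
    · have := congrArg (coeff (mon (m 0 - 1) (m 1))) h0
      rw [coeff_pderiv, mon_add_zero, Nat.sub_add_cancel (Nat.pos_of_ne_zero hm), mon_eta] at this
      simp only [coeff_zero, mul_eq_zero] at this
      exact this.resolve_right (Nat.cast_add_one_ne_zero _)

/-- The matrix of the linear system, on monomials. -/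
def ent {R : Type} [CommRing R] (G : ℕ → ℕ → R) (c1 c2 : ℕ) (w : ℕ × ℕ) (e : Bool × ℕ × ℕ) : R :=
  if e.1 then
    (if e.2.1 ≤ w.1 + 1 ∧ e.2.2 ≤ w.2 then
      (c2 * (w.1 + 1 - e.2.1 : ℕ) - c1 * e.2.1) * G (w.1 + 1 - e.2.1) (w.2 - e.2.2) else 0)
  else
    (if e.2.1 ≤ w.1 ∧ e.2.2 ≤ w.2 + 1 then
      (c1 * e.2.2 - c2 * (w.2 + 1 - e.2.2 : ℕ)) * G (w.1 - e.2.1) (w.2 + 1 - e.2.2) else 0)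

def val (A B : PP) (e : Bool × ℕ × ℕ) : ℂ := coeff (mon e.2.1 e.2.2) (if e.1 then B else A)

theorem coeff_A (P : PP) (c1 c2 : ℕ) (u v k l : ℕ) (a : ℂ) :
    coeff (mon u v) (C (c1 : ℂ) * (P * pderiv 1 (monomial (mon k l) a))
      - C (c2 : ℂ) * (monomial (mon k l) a * pderiv 1 P)) =
    ent (fun s t => coeff (mon s t) P) c1 c2 (u, v) (false, k, l) * a := by
  rw [coeff_sub, coeff_C_mul, coeff_C_mul, pderiv_monomial, coeff_mul_monomial',
    coeff_monomial_mul']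
  simp only [mon_sub_one, mon_le, mon_sub, coeff_pderiv, mon_add_one, ent, mon_one, Bool.false_eq_true, if_false]
  by_cases h1 : k ≤ u
  · by_cases h2 : l ≤ v
    · have h3 : l ≤ v + 1 := by omega
      have h4 : l - 1 ≤ v := by omega
      rw [if_pos ⟨h1, h4⟩, if_pos ⟨h1, h2⟩, if_pos ⟨h1, h3⟩]
      have e1 : v + 1 - l = v - l + 1 := by omega
      rcases Nat.eq_zero_or_pos l with rfl | hl
      · simp; ring
      · have e2 : v - (l - 1) = v - l + 1 := by omega
        rw [e1, e2]; push_cast; ring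
    · by_cases h3 : l = v + 1
      · subst h3
        simp [h1]; ring
      · rw [if_neg (by omega), if_neg (by omega), if_neg (by omega)]; simp
  · simp [h1]

theorem coeff_B (P : PP) (c1 c2 : ℕ) (u v k l : ℕ) (a : ℂ) :
    coeff (mon u v) (C (c2 : ℂ) * (monomial (mon k l) a * pderiv 0 P)
      - C (c1 : ℂ) * (P * pderiv 0 (monomial (mon k l) a))) =
    ent (fun s t => coeff (mon s t) P) c1 c2 (u, v) (true, k, l) * a := by
  rw [coeff_sub, coeff_C_mul, coeff_C_mul, pderiv_monomial, coeff_mul_monomial',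
    coeff_monomial_mul']
  simp only [mon_sub_zero, mon_le, mon_sub, coeff_pderiv, mon_add_zero, ent, mon_zero, if_true]
  by_cases h1 : l ≤ v
  · by_cases h2 : k ≤ u
    · have h3 : k ≤ u + 1 := by omega
      have h4 : k - 1 ≤ u := by omega
      rw [if_pos ⟨h2, h1⟩, if_pos ⟨h4, h1⟩, if_pos ⟨h3, h1⟩]
      have e1 : u + 1 - k = u - k + 1 := by omega
      rcases Nat.eq_zero_or_pos k with rfl | hl
      · simp; ring
      · have e2 : u - (k - 1) = u - k + 1 := by omega
        rw [e1, e2]; push_cast; ring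
    · by_cases h3 : k = u + 1
      · subst h3
        simp [h1]; ring
      · rw [if_neg (by omega), if_neg (by omega), if_neg (by omega)]; simp
  · simp [h1]

theorem expand (b : Bool) (A : PP) (S : Finset (Bool × ℕ × ℕ))
    (hA : ∀ k l, (b, k, l) ∉ S → coeff (mon k l) A = 0) :
    A = ∑ e ∈ S, if e.1 = b then monomial (mon e.2.1 e.2.2) (coeff (mon e.2.1 e.2.2) A) else 0 := by
  ext m
  rw [coeff_sum]
  have : ∀ e ∈ S, coeff m (if e.1 = b then
      monomial (mon e.2.1 e.2.2) (coeff (mon e.2.1 e.2.2) A) else 0) =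
      if e = (b, m 0, m 1) then coeff m A else 0 := by
    rintro ⟨b', k, l⟩ -
    by_cases hb : b' = b
    · subst hb
      simp only [if_true, coeff_monomial, Prod.mk.injEq, true_and]
      rw [← mon_eta m]
      simp only [mon_inj, mon_zero, mon_one]
      split_ifs with h
      · rw [h.1, h.2]
      · rfl
    · simp [hb]
  rw [Finset.sum_congr rfl this, Finset.sum_ite_eq']
  split_ifs with h
  · rfl
  · have := hA _ _ h
    rwa [mon_eta] at this

theorem system (P A B : PP) (c1 c2 : ℕ)
    (h : C (c1 : ℂ) * (P * (pderiv 1 A - pderiv 0 B)) =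
      C (c2 : ℂ) * (A * pderiv 1 P - B * pderiv 0 P))
    (S : Finset (Bool × ℕ × ℕ))
    (hA : ∀ k l, (false, k, l) ∉ S → coeff (mon k l) A = 0)
    (hB : ∀ k l, (true, k, l) ∉ S → coeff (mon k l) B = 0) (w : ℕ × ℕ) :
    ∑ e ∈ S, ent (fun s t => coeff (mon s t) P) c1 c2 w e * val A B e = 0 := by
  obtain ⟨u, v⟩ := w
  have h' : (C (c1 : ℂ) * (P * pderiv 1 A) - C (c2 : ℂ) * (A * pderiv 1 P)) +
      (C (c2 : ℂ) * (B * pderiv 0 P) - C (c1 : ℂ) * (P * pderiv 0 B)) = 0 := by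
    linear_combination h
  have e1 : C (c1 : ℂ) * (P * pderiv 1 A) - C (c2 : ℂ) * (A * pderiv 1 P) =
      ∑ e ∈ S, if e.1 = false then
        (C (c1 : ℂ) * (P * pderiv 1 (monomial (mon e.2.1 e.2.2) (coeff (mon e.2.1 e.2.2) A)))
        - C (c2 : ℂ) * (monomial (mon e.2.1 e.2.2) (coeff (mon e.2.1 e.2.2) A) * pderiv 1 P))
        else 0 := by
    conv_lhs => rw [expand false A S hA]
    rw [map_sum, Finset.mul_sum, Finset.mul_sum, Finset.sum_mul, Finset.mul_sum,
      ← Finset.sum_sub_distrib]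
    refine Finset.sum_congr rfl fun e _ => ?_
    split_ifs <;> simp
  have e2 : C (c2 : ℂ) * (B * pderiv 0 P) - C (c1 : ℂ) * (P * pderiv 0 B) =
      ∑ e ∈ S, if e.1 = true then
        (C (c2 : ℂ) * (monomial (mon e.2.1 e.2.2) (coeff (mon e.2.1 e.2.2) B) * pderiv 0 P)
        - C (c1 : ℂ) * (P * pderiv 0 (monomial (mon e.2.1 e.2.2) (coeff (mon e.2.1 e.2.2) B))))
        else 0 := by
    conv_lhs => rw [expand true B S hB]
    rw [map_sum, Finset.mul_sum, Finset.mul_sum, Finset.sum_mul, Finset.mul_sum,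
      ← Finset.sum_sub_distrib]
    refine Finset.sum_congr rfl fun e _ => ?_
    split_ifs <;> simp
  rw [e1, e2, ← Finset.sum_add_distrib] at h'
  have h2 := congrArg (coeff (mon u v)) h'
  rw [coeff_sum, coeff_zero] at h2
  rw [← h2]
  refine Finset.sum_congr rfl fun e _ => ?_
  obtain ⟨b, k, l⟩ := e
  cases b
  · simp only [if_true, Bool.false_eq_true, if_false, add_zero]
    rw [coeff_A]; simp [val]
  · simp only [if_true, Bool.true_eq_false, if_false, zero_add]
    rw [coeff_B]; simp [val]

def tab : List (List (ℤ√(-1407))) := [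
  [⟨1685533941, 0⟩,
   ⟨0, -47486250⟩,
   ⟨-4279726773, 0⟩,
   ⟨0, 94972500⟩,
   ⟨3502851723, 0⟩,
   ⟨0, -47486250⟩,
   ⟨-908658891, 0⟩],
  [⟨-10113203646, 52300350⟩,
   ⟨5317776198, 237431250⟩,
   ⟨17118907092, -171965700⟩,
   ⟨-6707489796, -284917500⟩,
   ⟨-7005703446, 119665350⟩,
   ⟨1389713598, 47486250⟩],
  [⟨22388359608, -261501750⟩,
   ⟨-21271104792, -348283800⟩,
   ⟨-18641354256, 515897100⟩,
   ⟨13414979592, 159553800⟩,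
   ⟨2166588648, -119665350⟩],
  [⟨-22132080792, 496694700⟩,
   ⟨28906437924, 95126400⟩,
   ⟨3044894328, -455114700⟩,
   ⟨-6707489796, 30391200⟩],
  [⟨8887630473, -444077100⟩,
   ⟨-15270666264, 142304850⟩,
   ⟨2757279609, 111183300⟩],
  [⟨-479642418, 182575350⟩,
   ⟨2317556934, -79092450⟩],
  [⟨-236597166, -25991550⟩]]

def tabN : List (List ℕ) := [
  [3, 2, 8, 7, 8, 2, 3], [7, 10, 7, 5, 8, 7], [6, 1, 7, 2, 2], [10, 7, 7, 8], [2, 10, 4],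
  [10, 3], [6]]

def colsA : List (Bool × ℕ × ℕ) := [
  (false, 0, 1), (false, 0, 2), (false, 0, 3), (false, 0, 4), (false, 0, 5), (false, 1, 0),
  (false, 1, 1), (false, 1, 2), (false, 1, 3), (false, 1, 4), (false, 2, 0), (false, 2, 1),
  (false, 2, 2), (false, 2, 3), (false, 3, 0), (false, 3, 1), (false, 3, 2), (false, 4, 0),
  (false, 4, 1), (false, 5, 0), (true, 0, 0), (true, 0, 1), (true, 0, 2), (true, 0, 3),
  (true, 0, 4), (true, 0, 5), (true, 1, 0), (true, 1, 1), (true, 1, 2), (true, 1, 3),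
  (true, 1, 4), (true, 2, 0), (true, 2, 1), (true, 2, 2), (true, 2, 3), (true, 3, 0),
  (true, 3, 1), (true, 3, 2), (true, 4, 0), (true, 4, 1), (true, 5, 0)]

def rowsA : List (ℕ × ℕ) := [
  (0, 0), (0, 1), (0, 2), (0, 3), (0, 4), (0, 5), (0, 6), (0, 7), (0, 8), (1, 0), (1, 1), (1, 2),
  (1, 3), (1, 4), (1, 5), (1, 6), (1, 7), (2, 0), (2, 1), (2, 2), (2, 3), (2, 4), (2, 5), (2, 6),
  (3, 0), (3, 1), (3, 2), (3, 3), (3, 4), (3, 5), (4, 0), (4, 1), (4, 2), (4, 3), (4, 4), (5, 0),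
  (5, 1), (5, 2), (5, 3), (5, 4), (7, 0)]

def invA : List ℕ := [
  650398964676721124980394427501465646628531, 4938676539802018227589715673235737119724390,
  470959150710043994310981773921993206189433, 810330185794569048180949340644160669944150,
  4288941785288865418268537875087944329504545, 3569731203385880264470900850563551487616758,
  2696677996454796923223132872641436634505928, 329536352161872805385608982399895911291621,
  800382506851863694637568033243054249508288, 549785289498043959941664369817961771987905,
  3061781112847876475768923915385046448541624, 926496878665595648370589868538513814579450,
  1058039512658705742004308423474708521162803, 3285554135131912071122318164473445146214488,
  4949193253425676293508921925137084773852502, 3218175240283900959225827510684746359533097,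
  4641315988171226978008603126485246478029289, 3613577136772004379550832392188233111180594,
  126966523053055998455128351916183672160222, 1846669901161752618539505101000324278574224,
  1891574921700210492174255444864442116160859, 100649938225478987197209368009296432395168,
  2889639464136456786857090392543436898239799, 4480523189287872314068481567323522995323040,
  615950685329831995660157579678287886264155, 917558654823914483286889174911874090729737,
  1779109123443466005599783826585169815005457, 1035499169941251393071761072550759703603744,
  4706123014306609886524404019360957458444912, 382677637230321666524366953757703951275151,
  1623440404397406732114486636751395872531054, 1145081686391284523035430023024417410742292,
  517880616946966179218271738623289240282631, 888108840375555069481470008932948976323262,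
  2219133970013428923098109711672377112667858, 2540602348618569217295923612141897985854772,
  4772715001152099097208986343465133464503109, 1314432824263390372769110769559520024418131,
  4879621219273115441924240454341998085761859, 398732542835765607859756217514487774726189,
  1246928960526691211602201588094797683418399]

def matA : List ℕ := [
  28117251474116307459445081074222886940, 1298354464372961726172090878076058896652,
  25164165556265370979799404787205151835326, 396488270135716355725262934328554609382942,
  246871221512874504066166785250027888358794, 95568893073752409932816501415988300059,
  2717941378950706649636033487123721811798076, 3524828530381015443425872080780544909140,
  200285132076888110322685276435587816974103, 359084414418110642682349132517935128140942,
  3624059425189545805935592158428582858708823, 4549757871783782196272839492056767514894961,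
  126095125497583505679631695624677106596308, 301956913013063003614628331781014587743264,
  465791798880197488974620794940773786174385, 1138471391215933775451493015690443077745581,
  370675506829548697640619873278339571361738, 2187044327385687908081472634604492882696808,
  4901351312392574432457944395834253133002134, 4571361576713545456513805309879109896214978,
  8431603531329036238590616572512364621, 92747638844619398624496782297636010831,
  1020224027290813384869464605273996119141, 11222464300198947233564110658013957310551,
  123435866240202162826165562386393405795049, 12690483982896506825844295189601,
  50588138017542585982583185736679662625, 556469518192968445808415043103476288875,
  6121164700122652903892565474138239177625, 67330001370417344474135770793582205774809,
  288014977391004593252194855098288409411386, 908195084448923795657057733532083618611881,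
  33109703939452354931976741175597302245869, 364184261384497413454530432754756622149532,
  385266758069601729005989283461212953351767, 4073335519918283645763420614306739167381192,
  2414274169319893542121737356779913664, 1264718002798143915965236386102324634,
  317225581960630199102288273245772509815305, 321308219549104099083191310379906583454486,
  955649896904372199017939285770668189018254]

def colsB : List (Bool × ℕ × ℕ) := [
  (false, 0, 0), (false, 0, 1), (false, 0, 2), (false, 0, 3), (false, 0, 4), (false, 1, 0),
  (false, 1, 1), (false, 1, 2), (false, 1, 3), (false, 2, 0), (false, 2, 1), (false, 2, 2),
  (false, 3, 0), (false, 3, 1), (false, 4, 0), (true, 0, 0), (true, 0, 1), (true, 0, 2),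
  (true, 0, 3), (true, 0, 4), (true, 1, 0), (true, 1, 1), (true, 1, 2), (true, 1, 3),
  (true, 2, 0), (true, 2, 1), (true, 2, 2), (true, 3, 0), (true, 3, 1), (true, 4, 0)]

def rowsB : List (ℕ × ℕ) := [
  (0, 0), (0, 1), (0, 2), (0, 3), (0, 4), (0, 5), (0, 6), (0, 7), (1, 0), (1, 1), (1, 2), (1, 3),
  (1, 4), (1, 5), (1, 6), (2, 0), (2, 1), (2, 2), (2, 3), (2, 4), (2, 5), (3, 0), (3, 1), (3, 2),
  (3, 3), (3, 4), (4, 0), (4, 1), (4, 2), (4, 3)]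

def invB : List ℕ := [
  324137280101584739655428259557, 2964504125499184839907132921250,
  14871516077027548650540765689385, 2173700390325480674046467773364,
  13112760614896808416154937655027, 15993958814651639685930937555684,
  11886068521365535383005617539914, 7136103591341635902022277324618,
  11922971814524418584859812820234, 11006830150315319707198036895453,
  3135719778279642360941156984557, 15161372518431193107027549851248,
  10562290745923105992756682572145, 13702947026764353006301387237624,
  8236173990210848604446113135132, 5319354431102991080430133078582,
  4352708003861543272143727965767, 1192153814889700162189107356126,
  12883634329300826571111206135956, 4322335989315712191541988072582,
  8965568055314405268716672563341, 8080411067157505328571857611714,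
  10343046279868645898717068357061, 3265519935204949360818752589369,
  8733121761213925600471861857832, 3083046113398202477549212618673,
  8632124684859311518668716595446, 13039605565662351375730617972968,
  10787291093742547778191053989887, 6708266468073208738939698236052]

def matB : List ℕ := [
  58400596910704514191656299469, 997605709173479386844803483243,
  13294544078455364044462353927111, 14709554964954686539700965082500,
  6345434190561815775354434362241, 246748953863444038067672439070,
  8750910936318462703588280648516, 5611655556678005689357643665503,
  5335903744142174669989776236687, 6876947862063638702848502646253,
  7084051299618141356354785879974, 5847849540999365138580889372011,
  8318291525413829229258059489913, 16726974735816789721541178957306,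
  8758667937575726206139515660589, 127527389910596115406341124697,
  1402801289016557269469752371667, 15430814179182129964167276088337,
  12690760024061908538167868318484, 758433880652668707215347102, 256307723958607920435904614683,
  2819384963544687124794950761513, 13556681364980498465472077918460,
  9518742263262030718370813365113, 4756187790868627248816665826369,
  17410918393804142969734179720656, 17017736845402553397075592706910,
  11008295173815950717346562738574, 16387682333532378099739325995254,
  7904869539440650014209970925674]

/-! ### Linear algebra modulo 11 -/

def Gt (k l : ℕ) : ℤ√(-1407) := (tab.getD k []).getD l 0

def GN (k l : ℕ) : ℕ := (tabN.getD k []).getD l 0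

/-- `ent` modulo 11, computed in `ℕ`. -/
def entN (c1 c2 : ℕ) (w : ℕ × ℕ) (e : Bool × ℕ × ℕ) : ℕ :=
  if e.1 then
    (if e.2.1 ≤ w.1 + 1 ∧ e.2.2 ≤ w.2 then
      (c2 * (w.1 + 1 - e.2.1) + 10 * (c1 * e.2.1)) * GN (w.1 + 1 - e.2.1) (w.2 - e.2.2) else 0)
  else
    (if e.2.1 ≤ w.1 ∧ e.2.2 ≤ w.2 + 1 then
      (c1 * e.2.2 + 10 * (c2 * (w.2 + 1 - e.2.2))) * GN (w.1 - e.2.1) (w.2 + 1 - e.2.2) else 0)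

def dig (n k : ℕ) : ℕ := n / 11 ^ k % 11

def dot : ℕ → ℕ → ℕ → ℕ
  | 0, _, _ => 0
  | n + 1, a, b => (a % 11) * (b % 11) + dot n (a / 11) (b / 11)

theorem dot_eq (n a b : ℕ) : ∑ k : Fin n, dig a k * dig b k = dot n a b := by
  induction n generalizing a b with
  | zero => rfl
  | succ n ih =>
    rw [Fin.sum_univ_succ, dot, ← ih]
    simp [dig, Nat.pow_succ', Nat.div_div_eq_div_mul]

def sC : ℂ := Complex.I * ((Real.sqrt 1407 : ℝ) : ℂ)

theorem sC_sq : sC * sC = ((-1407 : ℤ) : ℂ) := by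
  have h : ((Real.sqrt 1407 : ℝ) : ℂ) * ((Real.sqrt 1407 : ℝ) : ℂ) = 1407 := by
    rw [← Complex.ofReal_mul, Real.mul_self_sqrt (by norm_num)]; norm_num
  have h2 := Complex.I_mul_I
  unfold sC
  push_cast
  linear_combination (Complex.I * Complex.I) * h + 1407 * h2

def φ : ℤ√(-1407) →+* ℂ := Zsqrtd.lift ⟨sC, sC_sq⟩

theorem φ_inj : Function.Injective φ :=
  Zsqrtd.lift_injective _ fun n h => by nlinarith [mul_self_nonneg n]

def ψ : ℤ√(-1407) →+* ZMod 11 := Zsqrtd.lift ⟨1, by decide⟩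

theorem ent_map {R T : Type} [CommRing R] [CommRing T] (f : R →+* T) (G : ℕ → ℕ → R) (c1 c2 : ℕ)
    (w : ℕ × ℕ) (e : Bool × ℕ × ℕ) : f (ent G c1 c2 w e) = ent (fun k l => f (G k l)) c1 c2 w e := by
  unfold ent
  split_ifs <;> simp

theorem tab_check : ∀ k < 7, ∀ l < 7, ((Gt k l).re + (Gt k l).im) % 11 = (GN k l : ℤ) := by
  decide +kernel

theorem getD_zero (L : List (List (ℤ√(-1407)))) (m : ℕ) (h : ∀ l ∈ L, l.length ≤ m) (k l : ℕ)
    (hk : L.length ≤ k ∨ m ≤ l) : (L.getD k []).getD l 0 = 0 := by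
  rcases lt_or_ge k L.length with h1 | h1
  · have h2 : m ≤ l := by omega
    apply List.getD_eq_default
    refine le_trans ?_ h2
    rw [List.getD_eq_getElem _ _ h1]
    exact h _ (List.getElem_mem h1)
  · rw [List.getD_eq_default _ _ h1]; rfl

theorem Gt_zero (k l : ℕ) (h : 7 ≤ k ∨ 7 ≤ l) : Gt k l = 0 :=
  getD_zero tab 7 (by simp [tab]) k l h

theorem GN_zero (k l : ℕ) (h : 7 ≤ k ∨ 7 ≤ l) : GN k l = 0 := by
  unfold GN
  rcases lt_or_ge k 7 with h1 | h1
  · have h2 : 7 ≤ l := by omega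
    apply List.getD_eq_default
    refine le_trans ?_ h2
    interval_cases k <;> simp [tabN]
  · rw [List.getD_eq_default _ _ (show tabN.length ≤ k from h1)]; rfl

theorem ψ_Gt (k l : ℕ) : ψ (Gt k l) = (GN k l : ZMod 11) := by
  by_cases h : 7 ≤ k ∨ 7 ≤ l
  · rw [Gt_zero k l h, GN_zero k l h]; simp
  · have := tab_check k (by omega) l (by omega)
    have h2 : ψ (Gt k l) = (((Gt k l).re + (Gt k l).im : ℤ) : ZMod 11) := by
      simp [ψ, Zsqrtd.lift]
    rw [h2, ← Int.cast_natCast (R := ZMod 11) (GN k l), ← this]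
    rw [ZMod.intCast_eq_intCast_iff]
    exact (Int.mod_modEq _ _).symm

theorem entN_eq (c1 c2 : ℕ) (w : ℕ × ℕ) (e : Bool × ℕ × ℕ) :
    ent (fun k l => ψ (Gt k l)) c1 c2 w e = (entN c1 c2 w e : ZMod 11) := by
  have h10 : (10 : ZMod 11) = -1 := by decide
  unfold ent entN
  split_ifs
  · simp only [ψ_Gt]; push_cast; rw [h10]; ring
  · simp
  · simp only [ψ_Gt]; push_cast; rw [h10]; ring
  · simp

theorem nonsing (n c1 c2 : ℕ) (rows : List (ℕ × ℕ)) (cols : List (Bool × ℕ × ℕ)) (U M : List ℕ)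
    (h1 : ∀ k < n, ∀ b < n,
      entN c1 c2 (rows.getD k (0, 0)) (cols.getD b (false, 0, 0)) % 11 = dig (M.getD b 0) k)
    (h2 : ∀ a < n, ∀ b < n, dot n (U.getD a 0) (M.getD b 0) % 11 = if a = b then 1 else 0)
    (v : Fin n → ℂ)
    (hv : ∀ k : Fin n, ∑ b : Fin n, ent (fun s t => φ (Gt s t)) c1 c2 (rows.getD k (0, 0))
      (cols.getD b (false, 0, 0)) * v b = 0) : v = 0 := by
  let W : Matrix (Fin n) (Fin n) (ℤ√(-1407)) :=
    fun k b => ent Gt c1 c2 (rows.getD k (0, 0)) (cols.getD b (false, 0, 0))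
  let V : Matrix (Fin n) (Fin n) (ZMod 11) := fun a k => (dig (U.getD a 0) k : ZMod 11)
  have hVW : V * W.map ψ = 1 := by
    ext a b
    rw [Matrix.mul_apply]
    have : ∀ k : Fin n, V a k * (W.map ψ) k b =
        ((dig (U.getD a 0) k * dig (M.getD b 0) k : ℕ) : ZMod 11) := by
      intro k
      have hW : (W.map ψ) k b =
          ψ (ent Gt c1 c2 (rows.getD k (0, 0)) (cols.getD b (false, 0, 0))) := rfl
      have hV : V a k = (dig (U.getD a 0) k : ZMod 11) := rfl
      rw [hW, hV, ent_map, entN_eq, ← h1 k k.2 b b.2, Nat.cast_mul, ZMod.natCast_mod]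
    rw [Finset.sum_congr rfl fun k _ => this k, ← Nat.cast_sum, dot_eq, ← ZMod.natCast_mod,
      h2 a a.2 b b.2, Matrix.one_apply]
    simp [Fin.ext_iff]
  have hdet : W.det ≠ 0 := by
    intro h
    have h3 := congrArg Matrix.det hVW
    rw [Matrix.det_mul, Matrix.det_one] at h3
    have h4 : (W.map ψ).det = ψ W.det := (RingHom.map_det ψ W).symm
    rw [h4, h, map_zero, mul_zero] at h3
    exact absurd h3 (by decide)
  have hdet2 : (W.map φ).det ≠ 0 := by
    have h4 : (W.map φ).det = φ W.det := (RingHom.map_det φ W).symm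
    rw [h4]
    exact (map_ne_zero_iff φ φ_inj).mpr hdet
  refine Matrix.eq_zero_of_mulVec_eq_zero hdet2 ?_
  ext k
  rw [Pi.zero_apply, ← hv k]
  simp only [Matrix.mulVec, dotProduct]
  refine Finset.sum_congr rfl fun b _ => ?_
  have hW : (W.map φ) k b =
      φ (ent Gt c1 c2 (rows.getD k (0, 0)) (cols.getD b (false, 0, 0))) := rfl
  rw [hW, ent_map]

theorem checkA1 : ∀ k < 41, ∀ b < 41,
    entN 1 1 (rowsA.getD k (0, 0)) (colsA.getD b (false, 0, 0)) % 11 = dig (matA.getD b 0) k := by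
  decide +kernel

theorem checkA2 : ∀ a < 41, ∀ b < 41,
    dot 41 (invA.getD a 0) (matA.getD b 0) % 11 = if a = b then 1 else 0 := by
  decide +kernel

theorem checkB1 : ∀ k < 30, ∀ b < 30,
    entN 6 5 (rowsB.getD k (0, 0)) (colsB.getD b (false, 0, 0)) % 11 = dig (matB.getD b 0) k := by
  decide +kernel

theorem checkB2 : ∀ a < 30, ∀ b < 30,
    dot 30 (invB.getD a 0) (matB.getD b 0) % 11 = if a = b then 1 else 0 := by
  decide +kernel

/-- The linear system has only the trivial solution. -/
theorem solve (n c1 c2 : ℕ) (rows : List (ℕ × ℕ)) (cols : List (Bool × ℕ × ℕ)) (U M : List ℕ)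
    (h1 : ∀ k < n, ∀ b < n,
      entN c1 c2 (rows.getD k (0, 0)) (cols.getD b (false, 0, 0)) % 11 = dig (M.getD b 0) k)
    (h2 : ∀ a < n, ∀ b < n, dot n (U.getD a 0) (M.getD b 0) % 11 = if a = b then 1 else 0)
    (hn : cols.length = n) (hd : cols.Nodup) (P A B : PP)
    (hP : ∀ k l, coeff (mon k l) P = φ (Gt k l))
    (h : C (c1 : ℂ) * (P * (pderiv 1 A - pderiv 0 B)) =
      C (c2 : ℂ) * (A * pderiv 1 P - B * pderiv 0 P))
    (hA : ∀ k l, (false, k, l) ∉ cols → coeff (mon k l) A = 0)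
    (hB : ∀ k l, (true, k, l) ∉ cols → coeff (mon k l) B = 0) : A = 0 ∧ B = 0 := by
  subst hn
  have hs := system P A B c1 c2 h cols.toFinset (by simpa using hA) (by simpa using hB)
  have hG : (fun s t => coeff (mon s t) P) = fun s t => φ (Gt s t) := by
    funext s t; exact hP s t
  rw [hG] at hs
  have hv := nonsing cols.length c1 c2 rows cols U M h1 h2
    (fun b => val A B (cols.getD b (false, 0, 0))) (by
      intro k
      rw [← hs (rows.getD k (0, 0)), List.sum_toFinset _ hd, ← Fin.sum_univ_fun_getElem]
      refine Finset.sum_congr rfl fun b _ => ?_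
      rw [List.getD_eq_getElem _ _ b.2])
  have hall : ∀ e ∈ cols, val A B e = 0 := by
    intro e he
    obtain ⟨m, hm, rfl⟩ := List.getElem_of_mem he
    have := congrFun hv ⟨m, hm⟩
    simp only [Pi.zero_apply] at this
    rwa [List.getD_eq_getElem _ _ hm] at this
  constructor
  · ext m
    rw [← mon_eta m, coeff_zero]
    by_cases hm : (false, m 0, m 1) ∈ cols
    · simpa [val] using hall _ hm
    · exact hA _ _ hm
  · ext m
    rw [← mon_eta m, coeff_zero]
    by_cases hm : (true, m 0, m 1) ∈ cols
    · simpa [val] using hall _ hm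
    · exact hB _ _ hm

/-! ### The expansion of `g` -/

def P0 : PP := C 56310016 * g

theorem φ_mk (a b : ℤ) : φ ⟨a, b⟩ = (a : ℂ) + b * sC := rfl

set_option maxHeartbeats 4000000 in
theorem P0_eq : P0 = ∑ k ∈ Finset.range 7, ∑ l ∈ Finset.range 7,
    monomial (mon k l) (φ (Gt k l)) := by
  have hs : sC ^ 2 + 1407 = 0 := by
    have := sC_sq
    push_cast at this
    linear_combination this
  apply MvPolynomial.funext
  intro v
  have hm : ∀ k l (a : ℂ), eval v (monomial (mon k l) a) = a * (v 0 ^ k * v 1 ^ l) := by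
    intro k l a
    rw [eval_monomial, Finsupp.prod_fintype _ _ (by simp), Fin.prod_univ_two]
    simp
  have hf : eval v f2 = (1 + 2 * v 0 ^ 2 - v 1 ^ 2 + v 0 * v 1 - 2 * v 0)
      + (25 / 1407 * (v 0 - v 0 ^ 2)) * sC := by
    simp only [f2, x, y, c, i, r, map_add, map_sub, map_mul, map_pow, eval_X, eval_C, map_one,
      map_ofNat, sC]
    push_cast; ring
  have hg : eval v g2 = (5 / 4 * v 1 ^ 2 - 5 / 4 * v 0 * v 1 - 1 / 4 * v 0 ^ 2 + 5 / 2 * v 0 - 5 / 4)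
      + (125 / 5628 * (v 0 ^ 2 - v 0)) * sC := by
    simp only [g2, x, y, c, i, r, map_add, map_sub, map_mul, map_pow, eval_X, eval_C, sC]
    push_cast; ring
  have hh : eval v h2 = (-155 / 16 * v 1 ^ 2 - 11 / 2 * v 0 * v 1 + 131449 / 7504 * v 0 ^ 2
      - 138953 / 3752 * v 0 + 138953 / 7504)
      + (2025 / 3752 * (v 0 * v 1 - v 1) + 275 / 2814 * (v 0 ^ 2 - v 0)) * sC := by
    simp only [h2, x, y, c, i, r, map_add, map_sub, map_mul, map_pow, map_neg, eval_X, eval_C,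
      sC]
    push_cast; ring
  have hL : eval v P0 = 56310016 * (eval v f2 ^ 3 + eval v g2 ^ 2 * eval v h2) := by
    simp [P0, g]
  rw [hL, hf, hg, hh]
  simp only [map_add, hm, Finset.sum_range_succ, Finset.sum_range_zero, Gt, tab,
    List.getD_cons_zero, List.getD_cons_succ, List.getD_nil, map_zero, φ_mk]
  push_cast
  generalize v 0 = X at *
  generalize v 1 = Y at *
  generalize sC = s at *
  linear_combination (56310016 * (
    3 * (1 + 2 * X ^ 2 - Y ^ 2 + X * Y - 2 * X) * (25 / 1407 * (X - X ^ 2)) ^ 2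
    + (125 / 5628 * (X ^ 2 - X)) ^ 2 * (-155 / 16 * Y ^ 2 - 11 / 2 * X * Y + 131449 / 7504 * X ^ 2
      - 138953 / 3752 * X + 138953 / 7504)
    + 2 * (5 / 4 * Y ^ 2 - 5 / 4 * X * Y - 1 / 4 * X ^ 2 + 5 / 2 * X - 5 / 4)
      * (125 / 5628 * (X ^ 2 - X)) * (2025 / 3752 * (X * Y - Y) + 275 / 2814 * (X ^ 2 - X))
    + ((25 / 1407 * (X - X ^ 2)) ^ 3 + (125 / 5628 * (X ^ 2 - X)) ^ 2
      * (2025 / 3752 * (X * Y - Y) + 275 / 2814 * (X ^ 2 - X))) * s)) * hs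

theorem coeff_P0 (k l : ℕ) : coeff (mon k l) P0 = φ (Gt k l) := by
  rw [P0_eq, coeff_sum]
  simp only [coeff_sum, coeff_monomial, mon_inj]
  by_cases h : 7 ≤ k ∨ 7 ≤ l
  · rw [Gt_zero k l h, map_zero]
    refine Finset.sum_eq_zero fun a ha => Finset.sum_eq_zero fun b hb => ?_
    rw [Finset.mem_range] at ha hb
    rw [if_neg (by omega)]
  · rw [Finset.sum_eq_single k, Finset.sum_eq_single l]
    · simp
    · intro b _ hb; simp [hb]
    · intro hb; exact absurd (Finset.mem_range.mpr (by omega)) hb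
    · intro b _ hb; simp [hb]
    · intro hb; exact absurd (Finset.mem_range.mpr (by omega)) hb

theorem coeff_g (k l : ℕ) : coeff (mon k l) g = φ (Gt k l) / 56310016 := by
  have := coeff_P0 k l
  rw [P0, coeff_C_mul] at this
  rw [← this]
  field_simp

theorem Gt_ne (k l : ℕ) (h : GN k l % 11 ≠ 0) : coeff (mon k l) g ≠ 0 := by
  rw [coeff_g]
  refine div_ne_zero ((map_ne_zero_iff φ φ_inj).mpr fun h0 => h ?_) (by norm_num)
  have h1 := ψ_Gt k l
  rw [h0, map_zero] at h1
  exact Nat.mod_eq_zero_of_dvd ((ZMod.natCast_eq_zero_iff _ _).mp h1.symm)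

theorem g_deg : g.totalDegree ≤ 6 := by
  refine Finset.sup_le fun m hm => ?_
  rw [mem_support_iff, ← mon_eta m, coeff_g] at hm
  have hs : (m.sum fun _ e => e) = m 0 + m 1 := by
    rw [Finsupp.sum_fintype _ _ (by simp), Fin.sum_univ_two]
  rw [hs]
  by_contra hlt
  have hz : Gt (m 0) (m 1) = 0 := by
    by_cases h : 7 ≤ m 0 ∨ 7 ≤ m 1
    · exact Gt_zero _ _ h
    · have : ∀ a < 7, ∀ b < 7, 6 < a + b → Gt a b = 0 := by decide +kernel
      exact this _ (by omega) _ (by omega) (by omega)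
  rw [hz] at hm
  simp at hm

theorem g_deg' : 6 ≤ g.totalDegree := by
  by_contra h
  exact Gt_ne 6 0 (by decide +kernel) (coeff_big (d := 5) (by omega) (by omega))

theorem g_ne : g ≠ 0 := by
  intro h
  have := g_deg'
  rw [h] at this
  simp at this

theorem scale (c1 c2 : ℕ) (A B : PP)
    (h : C (c1 : ℂ) * (g * (pderiv 1 A - pderiv 0 B)) =
      C (c2 : ℂ) * (A * pderiv 1 g - B * pderiv 0 g)) :
    C (c1 : ℂ) * (P0 * (pderiv 1 A - pderiv 0 B)) =
      C (c2 : ℂ) * (A * pderiv 1 P0 - B * pderiv 0 P0) := by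
  rw [P0, pderiv_C_mul, pderiv_C_mul]
  linear_combination C 56310016 * h

theorem closedB (A B : PP) (hA : A.totalDegree ≤ 4) (hB : B.totalDegree ≤ 4)
    (h : C 6 * (g * (pderiv 1 A - pderiv 0 B)) = C 5 * (A * pderiv 1 g - B * pderiv 0 g)) :
    A = 0 ∧ B = 0 := by
  have hc : ∀ b ∈ [false, true], ∀ k < 5, ∀ l < 5, k + l ≤ 4 → (b, k, l) ∈ colsB := by decide +kernel
  refine solve 30 6 5 rowsB colsB invB matB checkB1 checkB2 (by decide +kernel) (by decide +kernel)
    P0 A B coeff_P0 (scale 6 5 A B (by exact_mod_cast h)) ?_ ?_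
  · intro k l hkl
    refine coeff_big hA ?_
    by_contra hlt
    exact hkl (hc _ (by simp) _ (by omega) _ (by omega) (by omega))
  · intro k l hkl
    refine coeff_big hB ?_
    by_contra hlt
    exact hkl (hc _ (by simp) _ (by omega) _ (by omega) (by omega))

theorem closedA' (A B : PP) (hA : A.totalDegree ≤ 5) (hB : B.totalDegree ≤ 5)
    (h : g * (pderiv 1 A - pderiv 0 B) = A * pderiv 1 g - B * pderiv 0 g)
    (h0 : coeff (mon 0 0) A = 0) :
    A = 0 ∧ B = 0 := by
  have hc : ∀ b ∈ [false, true], ∀ k < 6, ∀ l < 6, k + l ≤ 5 →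
      (b, k, l) ∈ (false, 0, 0) :: colsA := by decide +kernel
  refine solve 41 1 1 rowsA colsA invA matA checkA1 checkA2 (by decide +kernel) (by decide +kernel)
    P0 A B coeff_P0 (scale 1 1 A B (by simpa using h)) ?_ ?_
  · intro k l hkl
    by_cases hlt : 5 < k + l
    · exact coeff_big hA hlt
    · have := (List.mem_cons.mp (hc false (by simp) k (by omega) l (by omega) (by omega))).resolve_right hkl
      simp only [Prod.mk.injEq, true_and] at this
      rw [this.1, this.2, h0]
  · intro k l hkl
    by_cases hlt : 5 < k + l
    · exact coeff_big hB hlt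
    · have := (List.mem_cons.mp (hc true (by simp) k (by omega) l (by omega) (by omega))).resolve_right hkl
      simp at this

theorem closedA (A B : PP) (hA : A.totalDegree ≤ 5) (hB : B.totalDegree ≤ 5)
    (h : g * (pderiv 1 A - pderiv 0 B) = A * pderiv 1 g - B * pderiv 0 g) :
    ∃ t : ℂ, A = C t * pderiv 0 g ∧ B = C t * pderiv 1 g := by
  have h10 : coeff (mon 0 0) (pderiv 0 g) ≠ 0 := by
    rw [coeff_pderiv, mon_add_zero]
    refine mul_ne_zero (Gt_ne 1 0 (by decide +kernel)) ?_
    simp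
  have hd : ∀ (t : ℂ) (D : PP) (a : Fin 2), D.totalDegree ≤ 5 →
      (D - C t * pderiv a g).totalDegree ≤ 5 := by
    intro t D a hD
    refine (totalDegree_sub _ _).trans (max_le hD ((totalDegree_mul _ _).trans ?_))
    rw [totalDegree_C, zero_add]
    exact pd_degree g_deg a
  obtain ⟨e1, e2⟩ := closedA'
    (A - C (coeff (mon 0 0) A / coeff (mon 0 0) (pderiv 0 g)) * pderiv 0 g)
    (B - C (coeff (mon 0 0) A / coeff (mon 0 0) (pderiv 0 g)) * pderiv 1 g)
    (hd _ _ _ hA) (hd _ _ _ hB) (by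
      rw [map_sub, map_sub, pderiv_C_mul, pderiv_C_mul, pd_comm]
      linear_combination h) (by
      rw [coeff_sub, coeff_C_mul, div_mul_cancel₀ _ h10, sub_self])
  exact ⟨_, sub_eq_zero.mp e1, sub_eq_zero.mp e2⟩

/-! ### Irreducibility -/

theorem dvd_pd {a : PP} (ha : Irreducible a) {t : Fin 2} (h : a ∣ pderiv t a) : pderiv t a = 0 := by
  by_contra h0
  obtain ⟨b, hb⟩ := h
  have hb0 : b ≠ 0 := by rintro rfl; exact h0 (by simpa using hb)
  have h1 : (pderiv t a).totalDegree = a.totalDegree + b.totalDegree := by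
    conv_lhs => rw [hb]
    exact totalDegree_mul_of_isDomain ha.ne_zero hb0
  rcases Nat.eq_zero_or_pos a.totalDegree with h2 | h2
  · rw [totalDegree_eq_zero_iff_eq_C.mp h2, pderiv_C] at h0
    exact h0 rfl
  · have := pd_degree (A := a) (d := a.totalDegree - 1) (by omega) t
    omega

theorem not_const {a : PP} (ha : Irreducible a) (h0 : pderiv 0 a = 0) (h1 : pderiv 1 a = 0) :
    False := by
  have h := const_of_pd h0 h1
  apply ha.not_isUnit
  rw [h]
  refine (IsUnit.mk0 _ ?_).map C
  intro h2
  rw [h2, map_zero] at h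
  exact ha.ne_zero h

theorem deg_part {a b d : PP} (hg : g = a * b) (hd : d.totalDegree + 1 ≤ a.totalDegree) :
    (b * d).totalDegree ≤ 5 := by
  have ha : a ≠ 0 := by rintro rfl; exact g_ne (by simpa using hg)
  have hb : b ≠ 0 := by rintro rfl; exact g_ne (by simpa using hg)
  have h1 := g_deg
  rw [hg, totalDegree_mul_of_isDomain ha hb] at h1
  have := totalDegree_mul b d
  omega

theorem irr_pos {a : PP} (ha : Irreducible a) (t : Fin 2) :
    (pderiv t a).totalDegree + 1 ≤ a.totalDegree := by
  rcases Nat.eq_zero_or_pos a.totalDegree with h2 | h2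
  · exfalso
    have h3 := totalDegree_eq_zero_iff_eq_C.mp h2
    exact not_const ha (by rw [h3, pderiv_C]) (by rw [h3, pderiv_C])
  · have := pd_degree (A := a) (d := a.totalDegree - 1) (by omega) t
    omega

theorem g_irred : Irreducible g := by
  have hnu : ¬ IsUnit g := by
    intro h
    have := g_deg'
    rw [MvPolynomial.isUnit_iff_totalDegree_of_isReduced] at h
    omega
  obtain ⟨a, ha, hag⟩ := WfDvdMonoid.exists_irreducible_factor hnu g_ne
  have hp : Prime a := ha.prime
  have hfin : FiniteMultiplicity a g := FiniteMultiplicity.of_prime_left hp g_ne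
  obtain ⟨e, he, hne⟩ := hfin.exists_eq_pow_mul_and_not_dvd
  set k := multiplicity a g with hk
  have hk1 : k ≠ 0 := by
    intro h0
    rw [h0, pow_zero, one_mul] at he
    exact hne (he ▸ hag)
  obtain ⟨n, hn⟩ : ∃ n, k = n + 1 := Nat.exists_eq_succ_of_ne_zero hk1
  rw [hn] at he
  have he1 : g = a * (a ^ n * e) := by rw [he, pow_succ]; ring
  have hpd : ∀ t : Fin 2, pderiv t g = (n + 1 : PP) * a ^ n * pderiv t a * e
      + a ^ (n + 1) * pderiv t e := by
    intro t
    rw [he, pderiv_mul, pderiv_pow]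
    simp
  have hpd1 : ∀ t : Fin 2, pderiv t g = pderiv t a * (a ^ n * e) + a * pderiv t (a ^ n * e) := by
    intro t
    rw [he1, pderiv_mul]
  obtain ⟨t, hA, hB⟩ := closedA (a ^ n * e * pderiv 0 a) (a ^ n * e * pderiv 1 a)
    (deg_part he1 (irr_pos ha 0)) (deg_part he1 (irr_pos ha 1)) (by
      rw [hpd1, hpd1, pderiv_mul (g := pderiv 0 a), pderiv_mul (g := pderiv 1 a), pd_comm]
      generalize a ^ n * e = b at *
      rw [he1]; ring)
  have han : a ^ n ≠ 0 := pow_ne_zero _ ha.ne_zero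
  have key : ∀ u : Fin 2, a ^ n * e * pderiv u a = C t * pderiv u g →
      C (1 - t * (n + 1)) * (e * pderiv u a) = a * (C t * pderiv u e) := by
    intro u hu
    rw [hpd] at hu
    apply mul_left_cancel₀ han
    have : (C (1 - t * (n + 1)) : PP) = 1 - C t * ((n : PP) + 1) := by simp
    rw [this]
    linear_combination hu
  have k0 := key 0 hA
  have k1 := key 1 hB
  have ht : 1 - t * (n + 1) = 0 := by
    by_contra hne0
    have hu : IsUnit (C (1 - t * (n + 1)) : PP) := (IsUnit.mk0 _ hne0).map C
    have hdv : ∀ u : Fin 2, C (1 - t * (n + 1)) * (e * pderiv u a) = a * (C t * pderiv u e) →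
        pderiv u a = 0 := by
      intro u hu2
      apply dvd_pd ha
      have h1 : a ∣ C (1 - t * (n + 1)) * (e * pderiv u a) := ⟨_, hu2⟩
      exact (hp.dvd_or_dvd (hu.dvd_mul_left.mp h1)).resolve_left hne
    exact not_const ha (hdv 0 k0) (hdv 1 k1)
  have ht0 : (C t : PP) ≠ 0 := by
    rw [Ne, C_eq_zero]
    rintro rfl
    simp at ht
  rw [ht, C_0, zero_mul] at k0 k1
  have z0 : pderiv 0 e = 0 :=
    (mul_eq_zero.mp ((mul_eq_zero.mp k0.symm).resolve_left ha.ne_zero)).resolve_left ht0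
  have z1 : pderiv 1 e = 0 :=
    (mul_eq_zero.mp ((mul_eq_zero.mp k1.symm).resolve_left ha.ne_zero)).resolve_left ht0
  have hec := const_of_pd z0 z1
  have he0 : e ≠ 0 := by rintro rfl; exact hne (dvd_zero a)
  have heu : IsUnit e := by
    rw [hec]
    refine (IsUnit.mk0 _ ?_).map C
    intro h2
    rw [h2, map_zero] at hec
    exact he0 hec
  rcases n with _ | n
  · rw [he, zero_add, pow_one]
    exact (irreducible_mul_isUnit heu).mpr ha
  · exfalso
    have he2 : g = a * (a ^ (n + 1) * e) := he1
    have hb0 : a ^ (n + 1) * e ≠ 0 := mul_ne_zero han he0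
    have hdeg : ∀ u : Fin 2, (a ^ n * e * pderiv u a).totalDegree ≤ 5 := by
      intro u
      have h1 : (a ^ (n + 1) * e * pderiv u a).totalDegree ≤ 5 := deg_part he2 (irr_pos ha u)
      by_cases hz : pderiv u a = 0
      · simp [hz]
      · have h2 : a ^ (n + 1) * e * pderiv u a = a * (a ^ n * e * pderiv u a) := by ring
        rw [h2, totalDegree_mul_of_isDomain ha.ne_zero
          (mul_ne_zero (mul_ne_zero (pow_ne_zero _ ha.ne_zero) he0) hz)] at h1
        omega
    have he3 : g = a ^ 2 * (a ^ n * e) := by rw [he]; ring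
    obtain ⟨t', hA', hB'⟩ := closedA (a ^ n * e * pderiv 0 a) (a ^ n * e * pderiv 1 a)
      (hdeg 0) (hdeg 1) (by
        have hq : ∀ u : Fin 2, pderiv u g = 2 * a * pderiv u a * (a ^ n * e)
            + a ^ 2 * pderiv u (a ^ n * e) := by
          intro u
          rw [he3, pderiv_mul, pderiv_pow]; simp
        rw [hq, hq, pderiv_mul (g := pderiv 0 a), pderiv_mul (g := pderiv 1 a), pd_comm]
        generalize a ^ n * e = b at *
        rw [he3]; ring)
    have hfin : ∀ u : Fin 2, pderiv u e = 0 → a ^ n * e * pderiv u a = C t' * pderiv u g →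
        pderiv u a = 0 := by
      intro u hue hu
      rw [hpd, hue] at hu
      have h3 : a ^ n * e * ((1 - a * (C t' * ((n : PP) + 1 + 1))) * pderiv u a) = 0 := by
        push_cast at hu
        linear_combination hu
      have h4 := (mul_eq_zero.mp h3).resolve_left (mul_ne_zero (pow_ne_zero _ ha.ne_zero) he0)
      refine (mul_eq_zero.mp h4).resolve_left fun h5 => ha.not_isUnit ?_
      exact IsUnit.of_mul_eq_one _ (sub_eq_zero.mp h5).symm
    exact not_const ha (hfin 0 z0 hA') (hfin 1 z1 hB')

theorem g_non_torus : ¬ ∃ p q : MvPolynomial (Fin 2) ℂ,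
    p.totalDegree ≤ 2 ∧ q.totalDegree ≤ 3 ∧ g = p ^ 3 + q ^ 2 := by
  rintro ⟨p, q, hp, hq, hpq⟩
  have hpd : ∀ u : Fin 2, pderiv u g = 3 * p ^ 2 * pderiv u p + 2 * q * pderiv u q := by
    intro u
    rw [hpq, map_add, pderiv_pow, pderiv_pow]; simp
  have hdeg : ∀ u : Fin 2, (C 2 * (p * pderiv u q) - C 3 * (q * pderiv u p)).totalDegree ≤ 4 := by
    intro u
    have h1 := pd_degree hp u
    have h2 := pd_degree hq u
    refine (totalDegree_sub _ _).trans (max_le ?_ ?_)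
    · refine (totalDegree_mul _ _).trans ?_
      rw [totalDegree_C]
      have := totalDegree_mul p (pderiv u q)
      omega
    · refine (totalDegree_mul _ _).trans ?_
      rw [totalDegree_C]
      have := totalDegree_mul q (pderiv u p)
      omega
  have c6 : (C 6 : PP) = 6 := map_ofNat C 6
  have c5 : (C 5 : PP) = 5 := map_ofNat C 5
  have c2 : (C 2 : PP) = 2 := map_ofNat C 2
  have c3 : (C 3 : PP) = 3 := map_ofNat C 3
  obtain ⟨z0, z1⟩ := closedB _ _ (hdeg 0) (hdeg 1) (by
    rw [hpd, hpd, map_sub, map_sub, pderiv_C_mul, pderiv_C_mul, pderiv_C_mul, pderiv_C_mul,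
      pderiv_mul, pderiv_mul, pderiv_mul, pderiv_mul, pd_comm p, pd_comm q, hpq, c6, c5, c2, c3]
    ring)
  have hdv : 2 * g * pderiv 0 q = q * pderiv 0 g := by
    rw [hpd, hpq]
    rw [c2, c3] at z0
    linear_combination p ^ 2 * z0
  have hg0 : pderiv 0 g ≠ 0 := by
    intro h
    have := congrArg (coeff (mon 0 0)) h
    rw [coeff_pderiv, mon_add_zero, coeff_zero] at this
    exact mul_ne_zero (Gt_ne 1 0 (by decide +kernel)) (by simp) this
  have hgd : g ∣ q * pderiv 0 g := ⟨2 * pderiv 0 q, by rw [← hdv]; ring⟩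
  have hq0 : q = 0 := by
    rcases g_irred.prime.dvd_or_dvd hgd with h | h
    · by_contra hq0
      have h1 := totalDegree_le_of_dvd_of_isDomain h hq0
      have := g_deg'
      omega
    · have h1 := totalDegree_le_of_dvd_of_isDomain h hg0
      have h2 := pd_degree g_deg 0
      have := g_deg'
      omega
  rw [hq0, zero_pow two_ne_zero, add_zero] at hpq
  have := g_irred
  rw [hpq] at this
  exact absurd this (not_irreducible_pow (by norm_num))

/-- `g` is irreducible and of non-torus type. -/
theorem g_irreducible_and_non_torus :
    Irreducible g ∧
      ¬ ∃ p q : MvPolynomial (Fin 2) ℂ,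
        p.totalDegree ≤ 2 ∧ q.totalDegree ≤ 3 ∧ g = p ^ 3 + q ^ 2 :=
  ⟨g_irred, g_non_torus⟩

end
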